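/- Let p ≥ 5 be a prime and let r be the unique integer with 1 ≤ r ≤ p − 1 such that 8r + 1 ≡ 0 (mod p). Then for all integers n ≥ 0 and i ≥ 1, A_{p, p i − 3}(p n + r) ≡ 0 (mod p). -/

import Mathlib

/-- Hook length of the cell in row `i`, column `j` (0-indexed) of the
Ferrers–Young diagram of the partition `p` (rows sorted in decreasing order). -/
def hookLength {n : ℕ} (p : n.Partition) (i j : ℕ) : ℕ :=
  (((p.parts.sort (· ≤ ·)).reverse.getD i 0 - j) +
    ((p.parts.filter (fun x => j < x)).card - i)) - 1

/-- A partition is a `t`-core if no hook number of its Ferrers–Young diagram is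
divisible by `t`. -/
def IsTCore (t : ℕ) {n : ℕ} (p : n.Partition) : Prop :=
  ∀ i j : ℕ, j < (p.parts.sort (· ≤ ·)).reverse.getD i 0 → ¬ t ∣ hookLength p i j

/-- `numA t k n` is the number of `k`-tuples of `t`-core partitions whose sizes sum to `n`. -/
noncomputable def numA (t k n : ℕ) : ℕ :=
  Nat.card { f : Fin k → Σ m : Fin (n + 1), Nat.Partition (m : ℕ) //
    (∑ i, ((f i).1 : ℕ)) = n ∧ ∀ i, IsTCore t (f i).2 }

/-- The Gaussian binomial coefficient, evaluated at `Q`. -/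
def gaussBinom {R : Type*} [CommRing R] (Q : R) : ℕ → ℕ → R
  | _, 0 => 1
  | 0, _ + 1 => 0
  | n + 1, k + 1 => gaussBinom Q n k + Q ^ (k + 1) * gaussBinom Q n (k + 1)

/-- The finite product `(Q; Q)_n = (1 - Q) ⋯ (1 - Q ^ n)`. -/
def qPoch {R : Type*} [CommRing R] (Q : R) (n : ℕ) : R :=
  ∏ m ∈ Finset.range n, (1 - Q ^ (m + 1))

/-- The triangular number `c (c + 1) / 2` of an integer `c`. -/
def triangular (c : ℤ) : ℕ := (c * (c + 1) / 2).toNat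

theorem two_mul_triangular (c : ℤ) : 2 * (triangular c : ℤ) = c * (c + 1) := by
  have h1 : 2 ∣ c * (c + 1) := (Int.even_mul_succ_self c).two_dvd
  have h2 : 0 ≤ c * (c + 1) := by
    rcases le_or_gt 0 c with h | h
    · positivity
    · nlinarith
  unfold triangular
  omega

section GaussBinom

variable {R : Type*} [CommRing R] (Q : R)

theorem gaussBinom_zero_right (n : ℕ) : gaussBinom Q n 0 = 1 := by
  cases n <;> rfl

theorem gaussBinom_succ_succ (n k : ℕ) : gaussBinom Q (n + 1) (k + 1) =
    gaussBinom Q n k + Q ^ (k + 1) * gaussBinom Q n (k + 1) := rfl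

theorem gaussBinom_eq_zero {n k : ℕ} (h : n < k) : gaussBinom Q n k = 0 := by
  induction n generalizing k with
  | zero => obtain ⟨k, rfl⟩ := Nat.exists_eq_succ_of_ne_zero h.ne'; rfl
  | succ n ih =>
    obtain ⟨k, rfl⟩ := Nat.exists_eq_succ_of_ne_zero (Nat.ne_zero_of_lt h)
    rw [Nat.succ_eq_add_one, gaussBinom_succ_succ, ih (by omega), ih (by omega)]
    simp

theorem gaussBinom_succ_succ' (n k : ℕ) : gaussBinom Q (n + 1) (k + 1) =
    Q ^ (n - k) * gaussBinom Q n k + gaussBinom Q n (k + 1) := by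
  induction n generalizing k with
  | zero => cases k <;> simp [gaussBinom]
  | succ n ih =>
    rcases lt_or_ge (n + 1) k with h | h
    · simp [gaussBinom_eq_zero Q (show n + 1 < k from h),
        gaussBinom_eq_zero Q (show n + 1 < k + 1 by omega),
        gaussBinom_eq_zero Q (show n + 1 + 1 < k + 1 by omega)]
    rw [gaussBinom_succ_succ]
    cases k with
    | zero =>
      have h1 := ih 0
      have h2 := gaussBinom_succ_succ Q n 0
      simp only [gaussBinom_zero_right, Nat.sub_zero] at h1 h2 ⊢
      linear_combination Q * h1 - h2
    | succ k =>
      have h1 := ih k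
      have h2 := ih (k + 1)
      have h3 := gaussBinom_succ_succ Q n k
      have h4 := gaussBinom_succ_succ Q n (k + 1)
      rcases Nat.lt_or_ge n (k + 1) with h' | h'
      · obtain rfl : n = k := by omega
        simp only [gaussBinom_eq_zero Q (show n < n + 1 by omega),
          gaussBinom_eq_zero Q (show n < n + 1 + 1 by omega)] at h1 h2 h3 h4 ⊢
        rw [h4]; simp
      · obtain ⟨d, rfl⟩ := Nat.exists_eq_add_of_le h'
        rw [show k + 1 + d - k = d + 1 by omega] at h1
        rw [show k + 1 + d - (k + 1) = d by omega] at h2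
        rw [show k + 1 + d + 1 - (k + 1) = d + 1 by omega]
        linear_combination h1 + Q ^ (k + 1 + 1) * h2 - Q ^ (d + 1) * h3 - h4

theorem qPoch_succ (n : ℕ) : qPoch Q (n + 1) = qPoch Q n * (1 - Q ^ (n + 1)) :=
  Finset.prod_range_succ _ _

theorem gaussBinom_mul_qPoch (n k : ℕ) :
    gaussBinom Q (n + k) k * qPoch Q k * qPoch Q n = qPoch Q (n + k) := by
  induction k generalizing n with
  | zero => simp [gaussBinom_zero_right, qPoch]
  | succ k ihk =>
    induction n with
    | zero =>
      have h : ∀ m, gaussBinom Q m m = 1 := by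
        intro m
        induction m with
        | zero => rfl
        | succ m ih =>
          rw [gaussBinom_succ_succ, ih, gaussBinom_eq_zero Q (Nat.lt_succ_self m)]; simp
      simp [h, qPoch]
    | succ n ihn =>
      have h1 := ihk (n + 1)
      rw [show n + 1 + (k + 1) = (n + 1 + k) + 1 by omega, gaussBinom_succ_succ, qPoch_succ Q (n + 1 + k)]
      rw [show n + (k + 1) = n + 1 + k by omega] at ihn
      rw [qPoch_succ Q k] at ihn ⊢
      rw [qPoch_succ Q n] at h1 ⊢
      linear_combination (1 - Q ^ (k + 1)) * h1 + Q ^ (k + 1) * (1 - Q ^ (n + 1)) * ihn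

theorem gaussBinom_two_step (L k : ℕ) : gaussBinom Q (2 * L + 2) (k + 2) =
    Q ^ (2 * L - k) * gaussBinom Q (2 * L) k + (1 + Q ^ (2 * L + 1)) * gaussBinom Q (2 * L) (k + 1)
      + Q ^ (k + 2) * gaussBinom Q (2 * L) (k + 2) := by
  rw [gaussBinom_succ_succ, gaussBinom_succ_succ', gaussBinom_succ_succ' Q (2 * L) (k + 1)]
  rcases Nat.lt_or_ge (2 * L) (k + 1) with h | h
  · simp [gaussBinom_eq_zero Q h]
  · obtain ⟨d, hd⟩ := Nat.exists_eq_add_of_le h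
    rw [hd, show k + 1 + d - (k + 1) = d by omega]
    ring

end GaussBinom

section TripleProduct

open Polynomial

variable {R : Type*} [CommRing R]

/-- The coefficient of `z ^ c` in Ramanujan's theta function `f(a z, b / z)`. -/
def thetaTerm (a b : R) (c : ℤ) : R := a ^ triangular c * b ^ triangular (c - 1)

theorem thetaTerm_sub_one (a b : R) {L : ℕ} {c : ℤ} {e : ℕ} (he : (e : ℤ) = L - c + 1) :
    a * (a * b) ^ L * thetaTerm a b (c - 1) = thetaTerm a b c * (a * b) ^ e := by
  have h1 := two_mul_triangular c
  have h2 := two_mul_triangular (c - 1)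
  have h3 := two_mul_triangular (c - 1 - 1)
  have h4 : 1 + L + triangular (c - 1) = triangular c + e := by zify; linarith
  have h5 : L + triangular (c - 1 - 1) = triangular (c - 1) + e := by zify; linarith
  calc _ = a ^ (1 + L + triangular (c - 1)) * b ^ (L + triangular (c - 1 - 1)) := by
        unfold thetaTerm; ring
    _ = _ := by rw [h4, h5]; unfold thetaTerm; ring

theorem thetaTerm_add_one (a b : R) {L : ℕ} {c : ℤ} {e : ℕ} (he : (e : ℤ) = L + c + 1) :
    b * (a * b) ^ L * thetaTerm a b (c + 1) = thetaTerm a b c * (a * b) ^ e := by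
  have h1 := two_mul_triangular c
  have h2 := two_mul_triangular (c - 1)
  have h3 := two_mul_triangular (c + 1)
  have h4 : L + triangular (c + 1) = triangular c + e := by zify; linarith
  have h5 : 1 + L + triangular c = triangular (c - 1) + e := by zify; linarith
  calc _ = a ^ (L + triangular (c + 1)) * b ^ (1 + L + triangular c) := by
        unfold thetaTerm; rw [add_sub_cancel_right]; ring
    _ = _ := by rw [h4, h5]; unfold thetaTerm; ring

/-- The truncated Jacobi product `∏_{m < L} (1 + a (ab)^m z) (z + b (ab)^m)`. -/
noncomputable def tripleProd (a b : R) (L : ℕ) : R[X] :=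
  ∏ m ∈ Finset.range L, ((1 + C (a * (a * b) ^ m) * X) * (X + C (b * (a * b) ^ m)))

theorem coeff_tripleProd (a b : R) (L k : ℕ) : (tripleProd a b L).coeff k =
    thetaTerm a b (k - L) * gaussBinom (a * b) (2 * L) k := by
  induction L generalizing k with
  | zero =>
    cases k with
    | zero => simp [tripleProd, thetaTerm, triangular, gaussBinom]
    | succ k => simp [tripleProd, gaussBinom, coeff_one]
  | succ L ih =>
    have hstep : tripleProd a b (L + 1) = C (a * (a * b) ^ L) * (tripleProd a b L * X * X) +
        C (1 + (a * b) ^ (2 * L + 1)) * (tripleProd a b L * X) +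
        C (b * (a * b) ^ L) * tripleProd a b L := by
      rw [tripleProd, Finset.prod_range_succ, ← tripleProd]
      have : C ((a * b) ^ (2 * L + 1)) = C (a * (a * b) ^ L) * C (b * (a * b) ^ L) := by
        rw [← C_mul]; congr 1; ring
      rw [C_add, this, C_1]
      ring
    rw [hstep, coeff_add, coeff_add, coeff_C_mul, coeff_C_mul, coeff_C_mul]
    match k with
    | 0 =>
      rw [← mul_one X, mul_coeff_zero, mul_one, coeff_X_zero, mul_coeff_zero, coeff_X_zero, ih]
      have := thetaTerm_add_one a b (L := L) (c := (0 : ℕ) - ((L + 1 : ℕ) : ℤ)) (e := 0)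
        (by push_cast; ring)
      rw [show ((0 : ℕ) - ((L + 1 : ℕ) : ℤ)) + 1 = (0 : ℕ) - (L : ℤ) by push_cast; ring] at this
      simp only [gaussBinom_zero_right, mul_zero, zero_add, mul_one]
      rw [this]; simp
    | 1 =>
      rw [show (1 : ℕ) = 0 + 1 from rfl, coeff_mul_X, coeff_mul_X, mul_coeff_zero, coeff_X_zero,
        ih, ih]
      have := thetaTerm_add_one a b (L := L) (c := (0 : ℕ) - (L : ℤ)) (e := 1)
        (by push_cast; ring)
      rw [show ((0 : ℕ) - (L : ℤ)) + 1 = (0 + 1 : ℕ) - (L : ℤ) by push_cast; ring] at this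
      rw [show ((0 + 1 : ℕ) - ((L + 1 : ℕ) : ℤ)) = (0 : ℕ) - (L : ℤ) by push_cast; ring,
        show 2 * (L + 1) = 2 * L + 1 + 1 by ring, gaussBinom_succ_succ, gaussBinom_succ_succ']
      simp only [gaussBinom_zero_right, mul_zero, zero_add, mul_one, Nat.sub_zero]
      linear_combination gaussBinom (a * b) (2 * L) 1 * this
    | k + 2 =>
      rw [show k + 2 = k + 1 + 1 from rfl, coeff_mul_X, coeff_mul_X, coeff_mul_X, ih, ih, ih]
      have h1 := thetaTerm_add_one a b (L := L) (c := (k + 1 : ℕ) - (L : ℤ)) (e := k + 2)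
        (by push_cast; ring)
      rw [show ((k + 1 : ℕ) - (L : ℤ)) + 1 = (k + 1 + 1 : ℕ) - (L : ℤ) by push_cast; ring] at h1
      rw [show ((k + 1 + 1 : ℕ) - ((L + 1 : ℕ) : ℤ)) = (k + 1 : ℕ) - (L : ℤ) by push_cast; ring,
        show 2 * (L + 1) = 2 * L + 2 by ring, gaussBinom_two_step]
      have h2 : a * (a * b) ^ L * (thetaTerm a b ((k : ℕ) - (L : ℤ)) * gaussBinom (a * b) (2 * L) k)
          = thetaTerm a b ((k + 1 : ℕ) - (L : ℤ)) *
            ((a * b) ^ (2 * L - k) * gaussBinom (a * b) (2 * L) k) := by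
        rcases lt_or_ge (2 * L) k with h | h
        · simp [gaussBinom_eq_zero _ h]
        · have h3 := thetaTerm_sub_one a b (L := L) (c := (k + 1 : ℕ) - (L : ℤ)) (e := 2 * L - k)
            (by push_cast [h]; ring)
          rw [show ((k + 1 : ℕ) - (L : ℤ)) - 1 = (k : ℕ) - (L : ℤ) by push_cast; ring] at h3
          linear_combination gaussBinom (a * b) (2 * L) k * h3
      rw [h2]
      linear_combination gaussBinom (a * b) (2 * L) (k + 2) * h1

end TripleProduct

theorem le_triangular {c : ℤ} {D : ℕ} (h : (D : ℤ) ≤ c ∨ c ≤ -(D + 1 : ℤ)) : D ≤ triangular c := by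
  have := two_mul_triangular c
  zify
  rcases h with h | h <;> nlinarith

section Nilpotent

open Polynomial

variable {R : Type*} [CommRing R]

theorem qPoch_eq_of_le {Q : R} {D N : ℕ} (hQ : Q ^ D = 0) (h : D ≤ N) :
    qPoch Q N = qPoch Q D := by
  induction N, h using Nat.le_induction with
  | base => rfl
  | succ N h ih => rw [qPoch_succ, ih, pow_eq_zero_of_le (by omega) hQ, sub_zero, mul_one]

theorem isUnit_qPoch {Q : R} (hQ : IsNilpotent Q) (n : ℕ) : IsUnit (qPoch Q n) := by
  induction n with
  | zero => simp [qPoch]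
  | succ n ih =>
    rw [qPoch_succ]
    exact ih.mul (hQ.pow_of_pos (Nat.succ_ne_zero n)).isUnit_one_sub

theorem thetaTerm_eq_zero {a b : R} {D : ℕ} (hQ : (a * b) ^ D = 0) {c : ℤ}
    (hc : (D : ℤ) + 1 ≤ c ∨ c ≤ -(D + 1 : ℤ)) : thetaTerm a b c = 0 := by
  obtain ⟨d, hd⟩ := Nat.exists_eq_add_of_le (le_triangular (D := D) (c := c) (by omega))
  obtain ⟨e, he⟩ := Nat.exists_eq_add_of_le (le_triangular (D := D) (c := c - 1) (by omega))
  calc thetaTerm a b c = (a * b) ^ D * (a ^ d * b ^ e) := by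
        unfold thetaTerm; rw [hd, he]; ring
    _ = 0 := by rw [hQ, zero_mul]

theorem coeff_tripleProd_mul_qPoch {a b : R} {D L : ℕ} (hQ : (a * b) ^ D = 0)
    (hL : 2 * D + 1 ≤ L) (k : ℕ) :
    (tripleProd a b L).coeff k * qPoch (a * b) D = thetaTerm a b (k - L) := by
  rw [coeff_tripleProd]
  by_cases hc : (D : ℤ) + 1 ≤ (k - L : ℤ) ∨ (k - L : ℤ) ≤ -(D + 1 : ℤ)
  · simp [thetaTerm_eq_zero hQ hc]
  · have h := gaussBinom_mul_qPoch (a * b) (2 * L - k) k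
    rw [show 2 * L - k + k = 2 * L by omega, qPoch_eq_of_le hQ (show D ≤ k by omega),
      qPoch_eq_of_le hQ (show D ≤ 2 * L - k by omega),
      qPoch_eq_of_le hQ (show D ≤ 2 * L by omega)] at h
    have hu := isUnit_qPoch (Q := a * b) ⟨D, hQ⟩ D
    have h1 : gaussBinom (a * b) (2 * L) k * qPoch (a * b) D = 1 :=
      hu.mul_right_cancel (by rw [h, one_mul])
    rw [mul_assoc, h1, mul_one]

theorem tripleProd_mul_qPoch {a b : R} {D L : ℕ} (hQ : (a * b) ^ D = 0) (hL : 2 * D + 1 ≤ L) :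
    tripleProd a b L * C (qPoch (a * b) D) =
      ∑ k ∈ Finset.range (2 * L + 1), C (thetaTerm a b (k - L)) * X ^ k := by
  ext k
  rw [coeff_mul_C, coeff_tripleProd_mul_qPoch hQ hL, finsetSum_coeff]
  simp only [coeff_C_mul, coeff_X_pow, mul_ite, mul_one, mul_zero, Finset.sum_ite_eq,
    Finset.mem_range]
  split_ifs with h
  · rfl
  · exact thetaTerm_eq_zero hQ (by omega)

theorem prod_range_mul_eq {M : Type*} [CommMonoid M] (f : ℕ → M) (t L : ℕ) :
    ∏ x ∈ Finset.range (t * L), f x =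
      ∏ j ∈ Finset.range t, ∏ m ∈ Finset.range L, f (j + t * m) := by
  rw [Finset.prod_comm]
  induction L with
  | zero => simp
  | succ L ih =>
    rw [Nat.mul_succ, Finset.prod_range_add, ih, Finset.prod_range_succ]
    simp only [add_comm]

theorem prod_tripleProd (q : R) (t L : ℕ) :
    ∏ j ∈ Finset.range t, tripleProd (q ^ j) (q ^ (t - j)) L = tripleProd 1 q (t * L) := by
  unfold tripleProd
  simp only [Finset.prod_mul_distrib]
  rw [prod_range_mul_eq, prod_range_mul_eq]
  congr 1
  · refine Finset.prod_congr rfl fun j hj => Finset.prod_congr rfl fun m _ => ?_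
    rw [Finset.mem_range] at hj
    rw [← pow_add, ← pow_mul, ← pow_add, one_mul, one_mul, show j + (t - j) = t by omega]
  · rw [← Finset.prod_range_reflect]
    refine Finset.prod_congr rfl fun j hj => Finset.prod_congr rfl fun m _ => ?_
    rw [Finset.mem_range] at hj
    rw [← pow_add, ← pow_mul, ← pow_add, one_mul, ← pow_succ',
      show t - 1 - j + (t - (t - 1 - j)) = t by omega]
    congr 3
    have : t - (t - 1 - j) = j + 1 := by omega
    rw [this]; ring

theorem coeff_prod_eq_sum (s : Finset ℕ) (f : ℕ → R[X]) (d : ℕ) :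
    (∏ j ∈ s, f j).coeff d = ∑ l ∈ s.finsuppAntidiag d, ∏ j ∈ s, (f j).coeff (l j) := by
  have := PowerSeries.coeff_prod (fun j => (f j : PowerSeries R)) d s
  simp only [Polynomial.coeff_coe] at this
  rw [← this, ← Polynomial.coeff_coe]
  congr 1
  exact map_prod (Polynomial.coeToPowerSeries.ringHom (R := R)) f s

theorem qPoch_mul_sum_thetaTerm {q : R} {D L t : ℕ} (ht : 1 ≤ t) (hq : q ^ D = 0)
    (hL : 2 * D + 1 ≤ L) :
    qPoch q D * ∑ l ∈ (Finset.range t).finsuppAntidiag (t * L), ∏ j ∈ Finset.range t,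
      thetaTerm (q ^ j) (q ^ (t - j)) (l j - L) = qPoch (q ^ t) D ^ t := by
  have hab : ∀ j ∈ Finset.range t, q ^ j * q ^ (t - j) = q ^ t := fun j hj => by
    rw [← pow_add]; congr 1; have := Finset.mem_range.1 hj; omega
  have hQ : (q ^ t) ^ D = 0 := by rw [pow_right_comm, hq, zero_pow (by omega)]
  have h1 : ∑ l ∈ (Finset.range t).finsuppAntidiag (t * L), ∏ j ∈ Finset.range t,
      thetaTerm (q ^ j) (q ^ (t - j)) (l j - L) =
      (tripleProd 1 q (t * L)).coeff (t * L) * qPoch (q ^ t) D ^ t := by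
    rw [← prod_tripleProd, coeff_prod_eq_sum, Finset.sum_mul]
    refine Finset.sum_congr rfl fun l _ => ?_
    rw [← Finset.card_range t, ← Finset.prod_const, Finset.card_range t, ← Finset.prod_mul_distrib]
    refine Finset.prod_congr rfl fun j hj => ?_
    rw [← coeff_tripleProd_mul_qPoch (by rw [hab j hj, hQ]) hL, hab j hj]
  have h2 := coeff_tripleProd_mul_qPoch (a := 1) (b := q) (D := D) (L := t * L) (by simpa using hq)
    (by nlinarith) (t * L)
  rw [one_mul, sub_self] at h2
  rw [h1, ← mul_assoc, mul_comm (qPoch q D), h2]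
  simp [thetaTerm, triangular]

theorem tripleProd_one_succ (q : R) (L : ℕ) : ∃ H : R[X],
    tripleProd 1 q (L + 1) = (X + 1) * H ∧
      H.eval (-1) = (-1) ^ (L + 1) * (qPoch q L * qPoch q (L + 1)) := by
  refine ⟨(∏ m ∈ Finset.range L, (1 + C (q ^ (m + 1)) * X)) *
    ∏ m ∈ Finset.range (L + 1), (X + C (q * q ^ m)), ?_, ?_⟩
  · rw [tripleProd, Finset.prod_mul_distrib, Finset.prod_range_succ']
    simp only [one_mul, pow_zero, C_1]
    ring
  · simp only [eval_mul, eval_prod, eval_add, eval_one, eval_X, eval_C, qPoch]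
    rw [mul_left_comm, ← Finset.card_range (L + 1), ← Finset.prod_const, Finset.card_range,
      ← Finset.prod_mul_distrib]
    congr 1 <;> refine Finset.prod_congr rfl fun m _ => by ring

theorem sum_neg_one_pow_mul {q : R} {D L : ℕ} (hq : q ^ D = 0) (hL : 2 * D + 1 ≤ L) :
    ∑ k ∈ Finset.range (2 * L + 1), (-1) ^ k * q ^ triangular (k - L - 1) = 0 := by
  obtain ⟨L, rfl⟩ : ∃ M, L = M + 1 := ⟨L - 1, by omega⟩
  obtain ⟨H, hH, -⟩ := tripleProd_one_succ q L
  have h := congrArg (Polynomial.eval (-1))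
    (tripleProd_mul_qPoch (a := 1) (b := q) (D := D) (by simpa using hq) hL)
  rw [hH, eval_finsetSum] at h
  simp only [eval_mul, eval_add, eval_X, eval_one, neg_add_cancel, zero_mul, eval_C, eval_pow,
    thetaTerm, one_pow, one_mul] at h
  rw [h]
  exact Finset.sum_congr rfl fun k _ => mul_comm _ _

/-- Jacobi's identity for the cube of the Euler product, modulo `q ^ D`. -/
theorem sum_mul_neg_one_pow_mul {q : R} {D L : ℕ} (hq : q ^ D = 0) (hL : 2 * D + 1 ≤ L) :
    ∑ k ∈ Finset.range (2 * L + 1), k * ((-1) ^ k * q ^ triangular (k - L - 1)) =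
      (-1) ^ (L + 1) * qPoch q D ^ 3 := by
  obtain ⟨L, rfl⟩ : ∃ M, L = M + 1 := ⟨L - 1, by omega⟩
  obtain ⟨H, hH, hH'⟩ := tripleProd_one_succ q L
  have h := congrArg (fun P => (derivative P).eval (-1))
    (tripleProd_mul_qPoch (a := 1) (b := q) (D := D) (by simpa using hq) hL)
  simp only [hH, derivative_mul, derivative_add, derivative_X, derivative_one, add_zero,
    derivative_C, mul_zero, eval_mul, eval_add, eval_X, eval_one, neg_add_cancel, zero_mul, eval_C,
    one_mul, hH', derivative_sum, eval_finsetSum, derivative_X_pow, eval_pow, thetaTerm,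
    one_pow, zero_add, map_natCast, eval_natCast] at h
  rw [qPoch_eq_of_le hq (show D ≤ L by omega), qPoch_eq_of_le hq (show D ≤ L + 1 by omega)] at h
  rw [show (-1 : R) ^ (L + 1 + 1) * qPoch q D ^ 3 =
    -((-1 : R) ^ (L + 1) * (qPoch q D * qPoch q D) * qPoch q D) by ring, h,
    ← Finset.sum_neg_distrib]
  refine Finset.sum_congr rfl fun k _ => ?_
  cases k with
  | zero => simp
  | succ k => rw [Nat.add_sub_cancel]; ring

end Nilpotent

section PowerSeriesModP

open PowerSeries

theorem X_pow_dvd_iff_mk_eq {R : Type*} [CommRing R] {D : ℕ} {f g : R⟦X⟧} :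
    X ^ D ∣ f - g ↔ Ideal.Quotient.mk (Ideal.span {(X : R⟦X⟧) ^ D}) f =
      Ideal.Quotient.mk (Ideal.span {(X : R⟦X⟧) ^ D}) g := by
  rw [Ideal.Quotient.eq, Ideal.mem_span_singleton]

theorem map_qPoch {R S : Type*} [CommRing R] [CommRing S] (φ : R →+* S) (q : R) (n : ℕ) :
    φ (qPoch q n) = qPoch (φ q) n := by
  simp [qPoch, map_prod]

theorem mk_X_pow_eq_zero {R : Type*} [CommRing R] (D : ℕ) :
    (Ideal.Quotient.mk (Ideal.span {(X : R⟦X⟧) ^ D}) X) ^ D = 0 := by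
  rw [← map_pow, Ideal.Quotient.eq_zero_iff_mem]
  exact Ideal.mem_span_singleton_self _

/-- The exponent of `q` contributed by `l` to the multiple theta series of `t`-cores. -/
def coreWeight (t L : ℕ) (l : ℕ →₀ ℕ) : ℕ :=
  ∑ j ∈ Finset.range t, (j * triangular (l j - L) + (t - j) * triangular (l j - L - 1))

theorem X_pow_dvd_qPoch_mul_sum_coreWeight (R : Type*) [CommRing R] {D L t : ℕ} (ht : 1 ≤ t)
    (hL : 2 * D + 1 ≤ L) :
    (X : R⟦X⟧) ^ D ∣ qPoch X D * ∑ l ∈ (Finset.range t).finsuppAntidiag (t * L),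
      X ^ coreWeight t L l - qPoch (X ^ t) D ^ t := by
  rw [X_pow_dvd_iff_mk_eq]
  simp only [map_mul, map_sum, map_pow, map_qPoch]
  rw [← qPoch_mul_sum_thetaTerm ht (mk_X_pow_eq_zero D) hL]
  congr 1
  refine Finset.sum_congr rfl fun l _ => ?_
  rw [coreWeight, ← Finset.prod_pow_eq_pow_sum]
  refine Finset.prod_congr rfl fun j _ => ?_
  rw [thetaTerm, ← pow_mul, ← pow_mul, pow_add]

theorem coeff_qPoch_cube_eq_zero {p : ℕ} [Fact p.Prime] (hp2 : p ≠ 2) {D m : ℕ} (hm : m < D)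
    (hpm : p ∣ 8 * m + 1) : coeff m (qPoch (X : (ZMod p)⟦X⟧) D ^ 3) = 0 := by
  have hq := mk_X_pow_eq_zero (R := ZMod p) D
  set L := 2 * D + 1 with hL
  have h1 := sum_neg_one_pow_mul hq hL.ge
  have h2 := sum_mul_neg_one_pow_mul hq hL.ge
  have e1 : (X : (ZMod p)⟦X⟧) ^ D ∣ ∑ k ∈ Finset.range (2 * L + 1),
      (-1) ^ k * X ^ triangular (k - L - 1) - 0 := by
    rw [X_pow_dvd_iff_mk_eq]
    simpa [map_sum] using h1
  have e2 : (X : (ZMod p)⟦X⟧) ^ D ∣ ∑ k ∈ Finset.range (2 * L + 1),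
      (k : (ZMod p)⟦X⟧) * ((-1) ^ k * X ^ triangular (k - L - 1)) -
        (-1) ^ (L + 1) * qPoch X D ^ 3 := by
    rw [X_pow_dvd_iff_mk_eq]
    simpa [map_sum, map_qPoch] using h2
  have e1' := X_pow_dvd_iff.1 e1 m hm
  have e2' := X_pow_dvd_iff.1 e2 m hm
  have hC : ∀ k : ℕ, ((-1) ^ k : (ZMod p)⟦X⟧) = C ((-1) ^ k) := fun k => by simp
  have hN : ∀ k : ℕ, (k : (ZMod p)⟦X⟧) = C (k : ZMod p) := fun k => by simp
  simp only [hC, hN, sub_zero, map_sum, map_sub, coeff_C_mul, coeff_X_pow] at e1' e2'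
  have h20 : (2 : ZMod p) ≠ 0 := by
    intro h
    have : (p : ℕ) ∣ 2 := (ZMod.natCast_eq_zero_iff 2 p).1 (by exact_mod_cast h)
    exact hp2 ((Nat.prime_dvd_prime_iff_eq Fact.out Nat.prime_two).1 this)
  have h3 : ∑ k ∈ Finset.range (2 * L + 1), (k : ZMod p) * ((-1) ^ k *
      if m = triangular (k - L - 1) then 1 else 0) = (L + 2⁻¹) * ∑ k ∈ Finset.range (2 * L + 1),
        ((-1) ^ k * if m = triangular (k - L - 1) then 1 else 0) := by
    rw [Finset.mul_sum]
    refine Finset.sum_congr rfl fun k _ => ?_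
    split_ifs with h
    · congr 1
      have ht := two_mul_triangular (k - L - 1)
      rw [← h] at ht
      have h4 : ((2 * (k - L) - 1 : ℤ) : ZMod p) ^ 2 = 0 := by
        rw [← Int.cast_pow, show (2 * (k - L) - 1 : ℤ) ^ 2 = ((8 * m + 1 : ℕ) : ℤ) by
          push_cast; linear_combination -4 * ht]
        rw [Int.cast_natCast, ZMod.natCast_eq_zero_iff]
        exact hpm
      have h5 := pow_eq_zero_iff (two_ne_zero) |>.1 h4
      push_cast at h5
      field_simp
      linear_combination h5
    · simp
  rw [h3, e1', mul_zero, zero_sub, neg_eq_zero] at e2'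
  exact (mul_eq_zero.1 e2').resolve_left (pow_ne_zero _ (by simp))

theorem coeff_pow_eq_zero_of_not_dvd {p : ℕ} [Fact p.Prime] (g : (ZMod p)⟦X⟧) {m : ℕ}
    (h : ¬ p ∣ m) : coeff m (g ^ p) = 0 := by
  have hp0 : p ≠ 0 := (Fact.out : p.Prime).ne_zero
  rw [← MvPowerSeries.map_frobenius_expand p hp0 (f := g)]
  have := coeff_expand_of_not_dvd p hp0 g h
  change frobenius (ZMod p) p (coeff m (expand p hp0 g)) = 0
  rw [this, map_zero]

theorem isUnit_qPoch_X (R : Type*) [CommRing R] (D : ℕ) : IsUnit (qPoch (X : R⟦X⟧) D) := by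
  rw [PowerSeries.isUnit_iff_constantCoeff]
  simp [qPoch, map_prod]

theorem coeff_pow_eq_zero_of_X_pow_dvd {p : ℕ} [Fact p.Prime] (hp2 : p ≠ 2) {D m k i : ℕ}
    (hm : m < D) (hpm : p ∣ 8 * m + 1) {G H : (ZMod p)⟦X⟧} (hk : k + 3 = p * i)
    (h : X ^ D ∣ qPoch X D * G - H ^ p) : coeff m (G ^ k) = 0 := by
  obtain ⟨u, hu⟩ := (isUnit_qPoch_X (ZMod p) D).exists_right_inv
  set E := qPoch (X : (ZMod p)⟦X⟧) D with hE
  have h1 : X ^ D ∣ G ^ k - E ^ 3 * (u ^ i * H ^ k) ^ p := by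
    have h2 : X ^ D ∣ (E * G) ^ k - (H ^ p) ^ k := h.trans (sub_dvd_pow_sub_pow _ _ _)
    have h3 : G ^ k - E ^ 3 * (u ^ i * H ^ k) ^ p =
        ((E * G) ^ k - (H ^ p) ^ k) * (E ^ 3 * (u ^ i) ^ p) := by
      have h4 : E ^ k * E ^ 3 * (u ^ i) ^ p = 1 := by
        rw [← pow_add, hk, ← pow_mul, mul_comm i p, ← mul_pow, hu, one_pow]
      linear_combination (-G ^ k) * h4
    rw [h3]
    exact h2.mul_right _
  have h5 := X_pow_dvd_iff.1 h1 m hm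
  rw [map_sub, sub_eq_zero] at h5
  rw [h5, coeff_mul]
  refine Finset.sum_eq_zero fun x hx => ?_
  replace hx := Finset.HasAntidiagonal.mem_antidiagonal.1 hx
  by_cases hd : p ∣ x.2
  · rw [coeff_qPoch_cube_eq_zero hp2 (by omega), zero_mul]
    rw [← hx] at hpm
    refine (Nat.dvd_add_left (hd.mul_left 8)).1 ?_
    rwa [show 8 * x.1 + 1 + 8 * x.2 = 8 * (x.1 + x.2) + 1 by ring]
  · rw [coeff_pow_eq_zero_of_not_dvd _ hd, mul_zero]

theorem numA_eq_sum (t k n : ℕ) : numA t k n = ∑ l ∈ Finset.piAntidiag (Finset.univ : Finset (Fin k)) n,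
    ∏ i, Nat.card {c : Nat.Partition (l i) // IsTCore t c} := by
  let e : { f : Fin k → Σ m : Fin (n + 1), Nat.Partition (m : ℕ) //
      (∑ i, ((f i).1 : ℕ)) = n ∧ ∀ i, IsTCore t (f i).2 } ≃
      Σ l : {l // l ∈ Finset.piAntidiag (Finset.univ : Finset (Fin k)) n},
        ∀ i, {c : Nat.Partition (l.1 i) // IsTCore t c} :=
    { toFun := fun f => ⟨⟨fun i => (f.1 i).1, by simpa using f.2.1⟩,
        fun i => ⟨(f.1 i).2, f.2.2 i⟩⟩
      invFun := fun g => ⟨fun i => ⟨⟨g.1.1 i, by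
          have h := g.1.2
          rw [Finset.mem_piAntidiag] at h
          exact Nat.lt_succ_of_le ((Finset.single_le_sum (f := g.1.1) (fun _ _ => Nat.zero_le _)
            (Finset.mem_univ i)).trans h.1.le)⟩,
            (g.2 i).1⟩, by
          have h := g.1.2
          rw [Finset.mem_piAntidiag] at h
          exact h.1, fun i => (g.2 i).2⟩
      left_inv := fun _ => rfl
      right_inv := fun _ => rfl }
  rw [numA, Nat.card_congr e, Nat.card_sigma]
  simp only [Nat.card_pi]
  exact Finset.sum_coe_sort _ fun l : Fin k → ℕ =>
    ∏ i, Nat.card {c : Nat.Partition (l i) // IsTCore t c}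

theorem natCast_numA (R : Type*) [CommRing R] (t k n : ℕ) : (numA t k n : R) =
    coeff n ((PowerSeries.mk fun m => (Nat.card {c : Nat.Partition m // IsTCore t c} : R)) ^ k) := by
  conv_rhs => rw [← Fintype.card_fin k, ← Finset.card_univ, ← Finset.prod_const]
  rw [coeff_prod, numA_eq_sum, Nat.cast_sum]
  refine Finset.sum_equiv Finsupp.equivFunOnFinite.symm ?_ ?_
  · intro l
    simp [Finset.mem_piAntidiag, Finset.mem_finsuppAntidiag]
  · intro l _
    simp
end PowerSeriesModP

section BetaSets

theorem lt_card_filter_range_iff {P : ℕ → Prop} [DecidablePred P] {N : ℕ}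
    (hP : ∀ i j, i ≤ j → P j → P i) (hN : ∀ i, P i → i < N) (i : ℕ) :
    i < ((Finset.range N).filter P).card ↔ P i := by
  have hex : ∃ k, ¬ P k := ⟨N, fun h => lt_irrefl _ (hN N h)⟩
  have hk : ∀ i, P i ↔ i < Nat.find hex := fun i =>
    ⟨fun h => by
      by_contra hlt
      exact Nat.find_spec hex (hP _ _ (not_lt.1 hlt) h),
    fun h => not_not.1 (Nat.find_min hex h)⟩
  have : (Finset.range N).filter P = Finset.range (Nat.find hex) := by
    ext x
    rw [Finset.mem_filter, Finset.mem_range, Finset.mem_range, ← hk]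
    exact ⟨fun h => h.2, fun h => ⟨hN x h, h⟩⟩
  rw [this, Finset.card_range, hk]

variable {m : ℕ}

/-- The length of the `i`-th row of the Ferrers–Young diagram of `c`. -/
def rowLength (c : Nat.Partition m) (i : ℕ) : ℕ := (c.parts.sort (· ≤ ·)).reverse.getD i 0

/-- The length of the `j`-th column of the Ferrers–Young diagram of `c`. -/
def colLength (c : Nat.Partition m) (j : ℕ) : ℕ := (c.parts.filter (fun x => j < x)).card

theorem card_parts_le (c : Nat.Partition m) : c.parts.card ≤ m := by
  have h := Multiset.card_nsmul_le_sum (s := c.parts) (a := 1) fun x hx => c.parts_pos hx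
  rwa [smul_eq_mul, mul_one, c.parts_sum] at h

theorem map_rowLength_range (c : Nat.Partition m) {N : ℕ} (hN : m ≤ N) :
    (Multiset.range N).map (rowLength c) =
      c.parts + Multiset.replicate (N - c.parts.card) 0 := by
  set l := (c.parts.sort (· ≤ ·)).reverse with hl
  have hlc : (l : Multiset ℕ) = c.parts := by
    rw [hl, Multiset.coe_reverse, Multiset.sort_eq]
  have hlen : l.length = c.parts.card := by rw [← hlc, Multiset.coe_card]
  have hle : l.length ≤ N := by rw [hlen]; exact (card_parts_le c).trans hN
  have : (List.range N).map (rowLength c) = l ++ List.replicate (N - l.length) 0 := by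
    refine List.ext_getElem (by simp; omega) fun i h1 h2 => ?_
    rw [List.getElem_map, List.getElem_range, rowLength, ← hl]
    by_cases hi : i < l.length
    · rw [List.getElem_append_left hi, List.getD_eq_getElem _ _ hi]
    · rw [List.getElem_append_right (by omega), List.getElem_replicate,
        List.getD_eq_default _ _ (by omega)]
  rw [← Multiset.coe_range, Multiset.map_coe, this, ← Multiset.coe_add, hlc, hlen,
    Multiset.coe_replicate]

theorem rowLength_antitone (c : Nat.Partition m) : Antitone (rowLength c) := by
  intro i j hij
  unfold rowLength
  set l := (c.parts.sort (· ≤ ·)).reverse with hl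
  rcases lt_or_ge j l.length with h | h
  · rw [List.getD_eq_getElem _ _ h, List.getD_eq_getElem _ _ (hij.trans_lt h)]
    have hs : l.Pairwise (· ≥ ·) := by
      rw [hl, List.pairwise_reverse]
      exact Multiset.pairwise_sort _ _
    rcases hij.eq_or_lt with rfl | hlt
    · exact le_rfl
    · exact List.pairwise_iff_getElem.1 hs i j _ h hlt
  · rw [List.getD_eq_default _ _ h]
    exact Nat.zero_le _

theorem rowLength_eq_zero (c : Nat.Partition m) {i : ℕ} (hi : m ≤ i) : rowLength c i = 0 := by
  refine List.getD_eq_default _ _ ?_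
  rw [List.length_reverse, Multiset.length_sort]
  exact (card_parts_le c).trans hi

theorem lt_colLength_iff (c : Nat.Partition m) (i j : ℕ) :
    i < colLength c j ↔ j < rowLength c i := by
  have h : colLength c j = ((Finset.range m).filter fun i => j < rowLength c i).card := by
    have h1 := congrArg (fun s => (s.filter (fun x => j < x)).card)
      (map_rowLength_range c le_rfl)
    simp only [Multiset.filter_add, Multiset.card_add, Multiset.filter_map,
      Multiset.card_map] at h1
    have h2 : (Multiset.replicate (m - c.parts.card) 0).filter (fun x => j < x) = 0 :=
      Multiset.filter_eq_nil.2 fun x hx => by simp [Multiset.eq_of_mem_replicate hx]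
    rw [h2, Multiset.card_zero, add_zero] at h1
    exact h1.symm
  rw [h]
  refine lt_card_filter_range_iff (P := fun i => j < rowLength c i)
    (fun a b hab hb => hb.trans_le (rowLength_antitone c hab)) (fun a ha => ?_) i
  by_contra hlt
  rw [rowLength_eq_zero c (not_lt.1 hlt)] at ha
  exact Nat.not_lt_zero _ ha

theorem sum_rowLength (c : Nat.Partition m) {N : ℕ} (hN : m ≤ N) :
    ∑ i ∈ Finset.range N, rowLength c i = m := by
  have h := congrArg Multiset.sum (map_rowLength_range c hN)
  rw [Multiset.sum_add, c.parts_sum, Multiset.sum_replicate, smul_zero, add_zero] at h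
  exact h

theorem eq_of_rowLength_eq {c d : Nat.Partition m}
    (h : ∀ i < m, rowLength c i = rowLength d i) : c = d := by
  have h1 : ∀ c : Nat.Partition m,
      ((Multiset.range m).map (rowLength c)).filter (0 < ·) = c.parts := fun c => by
    rw [map_rowLength_range c le_rfl, Multiset.filter_add,
      Multiset.filter_eq_self.2 fun x hx => c.parts_pos hx,
      Multiset.filter_eq_nil.2 fun x hx => by simp [Multiset.eq_of_mem_replicate hx], add_zero]
  ext1
  rw [← h1 c, ← h1 d]
  congr 1
  exact Multiset.map_congr rfl fun x hx => h x (Multiset.mem_range.1 hx)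

theorem exists_rowLength_eq {r : ℕ → ℕ} (hr : Antitone r) {N : ℕ} (hN : ∀ i, N ≤ i → r i = 0)
    (hs : ∑ i ∈ Finset.range N, r i = m) : ∃ c : Nat.Partition m, ∀ i, rowLength c i = r i := by
  have hs' : ((Multiset.range N).map r).sum = m := hs
  refine ⟨Nat.Partition.ofSums m ((Multiset.range N).map r) hs', fun i => ?_⟩
  refine eq_of_forall_lt_iff fun j => ?_
  rw [← lt_colLength_iff]
  have h : colLength (Nat.Partition.ofSums m ((Multiset.range N).map r) hs') j =
      ((Finset.range N).filter fun i => j < r i).card := by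
    change (((Multiset.map r (Multiset.range N)).filter (· ≠ 0)).filter (fun x => j < x)).card = _
    rw [Multiset.filter_filter, Multiset.filter_congr (q := fun x => j < x) fun x _ => ⟨fun h => h.1, fun h => ⟨h, by omega⟩⟩,
      Multiset.filter_map, Multiset.card_map]
    rfl
  rw [h]
  refine lt_card_filter_range_iff (P := fun i => j < r i)
    (fun a b hab hb => hb.trans_le (hr hab)) (fun a ha => ?_) i
  by_contra hlt
  rw [hN a (not_lt.1 hlt)] at ha
  exact Nat.not_lt_zero _ ha

/-- The first-column hook lengths of `c`, viewed as a partition with `N` rows. -/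
def beta (N : ℕ) (c : Nat.Partition m) (i : ℕ) : ℕ := rowLength c i + (N - 1 - i)

/-- The set of the numbers `beta N c i` with `i < N`. -/
def betaSet (N : ℕ) (c : Nat.Partition m) : Finset ℕ := (Finset.range N).image (beta N c)

theorem beta_strictAntiOn (N : ℕ) (c : Nat.Partition m) {i j : ℕ} (hij : i < j) (hj : j < N) :
    beta N c j < beta N c i := by
  have := rowLength_antitone c hij.le
  unfold beta
  omega

theorem beta_injOn (N : ℕ) (c : Nat.Partition m) : Set.InjOn (beta N c) (Finset.range N) := by
  intro i hi j hj hij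
  simp only [Finset.coe_range, Set.mem_Iio] at hi hj
  rcases lt_trichotomy i j with h | h | h
  · exact absurd hij (beta_strictAntiOn N c h hj).ne'
  · exact h
  · exact absurd hij (beta_strictAntiOn N c h hi).ne

theorem card_betaSet (N : ℕ) (c : Nat.Partition m) : (betaSet N c).card = N := by
  rw [betaSet, Finset.card_image_of_injOn (beta_injOn N c), Finset.card_range]

theorem sum_betaSet {N : ℕ} (hN : m ≤ N) (c : Nat.Partition m) :
    2 * ∑ x ∈ betaSet N c, x = 2 * m + N * (N - 1) := by
  rw [betaSet, Finset.sum_image (beta_injOn N c)]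
  simp only [beta]
  rw [Finset.sum_add_distrib, sum_rowLength c hN, Finset.sum_range_reflect (fun i => i), mul_add,
    mul_comm 2 (∑ i ∈ _, _), Finset.sum_range_id_mul_two]

theorem card_filter_beta_lt (N : ℕ) (c : Nat.Partition m) {i : ℕ} (hi : i < N) :
    ((betaSet N c).filter (beta N c i < ·)).card = i := by
  have : (betaSet N c).filter (beta N c i < ·) = (Finset.range i).image (beta N c) := by
    ext x
    simp only [betaSet, Finset.mem_filter, Finset.mem_image, Finset.mem_range]
    constructor
    · rintro ⟨⟨k, hk, rfl⟩, h⟩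
      refine ⟨k, ?_, rfl⟩
      by_contra hlt
      rcases (not_lt.1 hlt).eq_or_lt with rfl | h'
      · exact lt_irrefl _ h
      · exact lt_asymm h (beta_strictAntiOn N c h' hk)
    · rintro ⟨k, hk, rfl⟩
      exact ⟨⟨k, hk.trans hi, rfl⟩, beta_strictAntiOn N c hk hi⟩
  rw [this, Finset.card_image_of_injOn, Finset.card_range]
  exact (beta_injOn N c).mono (by simpa using Set.Iio_subset_Iio hi.le)

theorem betaSet_injective {N : ℕ} (hN : m ≤ N) :
    Function.Injective (betaSet N : Nat.Partition m → Finset ℕ) := by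
  intro c d h
  refine eq_of_rowLength_eq fun i hi => ?_
  have hiN := hi.trans_le hN
  have h1 : beta N c i ∈ betaSet N d := by
    rw [← h]; exact Finset.mem_image_of_mem _ (Finset.mem_range.2 hiN)
  obtain ⟨k, hk, hki⟩ := Finset.mem_image.1 h1
  have h2 := card_filter_beta_lt N c hiN
  have h3 := card_filter_beta_lt N d (Finset.mem_range.1 hk)
  rw [hki, ← h, h2] at h3
  subst h3
  unfold beta at hki
  omega

theorem exists_betaSet_eq {N : ℕ} {s : Finset ℕ} (hs : s.card = N)
    (hsum : 2 * ∑ x ∈ s, x = 2 * m + N * (N - 1)) : ∃ c : Nat.Partition m, betaSet N c = s := by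
  have hcard : ∀ hf : (Set.ofPred (· ∈ s)).Finite, hf.toFinset.card = N := fun hf => by
    rw [← hs]
    congr 1
    ext x
    exact hf.mem_toFinset
  have hmono := Nat.nth_strictMonoOn (p := (· ∈ s)) s.finite_toSet
  rw [hcard] at hmono
  set e := Nat.nth (· ∈ s) with he
  have hmem : ∀ k < N, e k ∈ s := fun k hk => Nat.nth_mem (p := (· ∈ s)) k fun h => by
    rw [hcard]; exact hk
  have himg : (Finset.range N).image (fun i => e (N - 1 - i)) = s := by
    refine Finset.eq_of_subset_of_card_le ?_ ?_
    · intro x hx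
      obtain ⟨i, hi, rfl⟩ := Finset.mem_image.1 hx
      rw [Finset.mem_range] at hi
      exact hmem _ (by omega)
    · rw [Finset.card_image_of_injOn, Finset.card_range, hs]
      intro i hi j hj hij
      simp only [Finset.coe_range, Set.mem_Iio] at hi hj
      have := hmono.injOn (show N - 1 - i ∈ Set.Iio N by simp; omega)
        (show N - 1 - j ∈ Set.Iio N by simp; omega) hij
      omega
  have hge : ∀ k < N, k ≤ e k := by
    intro k
    induction k with
    | zero => intro _; exact Nat.zero_le _
    | succ k ih =>
      intro hk
      exact (ih (by omega)).trans_lt (hmono (by simp; omega) (by simpa using hk) (Nat.lt_succ_self k))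
  set r : ℕ → ℕ := fun i => if i < N then e (N - 1 - i) - (N - 1 - i) else 0 with hr
  have hanti : Antitone r := by
    refine antitone_nat_of_succ_le fun i => ?_
    simp only [hr]
    split_ifs with h1 h2
    · have := hmono (a := N - 1 - (i + 1)) (b := N - 1 - i) (by simp; omega) (by simp; omega)
        (by omega)
      omega
    · omega
    · exact Nat.zero_le _
    · exact le_rfl
  have hbeta : ∀ i < N, r i + (N - 1 - i) = e (N - 1 - i) := fun i hi => by
    simp only [hr, if_pos hi]
    exact Nat.sub_add_cancel (hge _ (by omega))
  have hrsum : ∑ i ∈ Finset.range N, r i = m := by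
    have h1 : ∑ x ∈ s, x = ∑ i ∈ Finset.range N, (r i + (N - 1 - i)) := by
      rw [Finset.sum_congr rfl fun i hi => hbeta i (Finset.mem_range.1 hi)]
      conv_lhs => rw [← himg]
      rw [Finset.sum_image]
      exact Finset.card_image_iff.1 (by rw [himg, hs, Finset.card_range])
    rw [Finset.sum_add_distrib, Finset.sum_range_reflect (fun i => i)] at h1
    have h2 := Finset.sum_range_id_mul_two N
    omega
  obtain ⟨c, hc⟩ := exists_rowLength_eq hanti (fun i hi => if_neg (not_lt.2 hi)) hrsum
  refine ⟨c, ?_⟩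
  rw [← himg, betaSet]
  refine Finset.image_congr fun i hi => ?_
  simp only [Finset.coe_range, Set.mem_Iio] at hi
  rw [beta, hc, hbeta i hi]

theorem colLength_le {N : ℕ} (hN : m ≤ N) (c : Nat.Partition m) (j : ℕ) : colLength c j ≤ N := by
  by_contra h
  have := (lt_colLength_iff c N j).1 (not_le.1 h)
  rw [rowLength_eq_zero c hN] at this
  exact Nat.not_lt_zero _ this

theorem mem_betaSet_or_exists {N : ℕ} (hN : m ≤ N) (c : Nat.Partition m) (y : ℕ) :
    y ∈ betaSet N c ∨ ∃ j, y = N + j - colLength c j := by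
  by_cases hy : y ∈ betaSet N c
  · exact Or.inl hy
  right
  have hne : ∀ i < N, beta N c i ≠ y := fun i hi h =>
    hy (h ▸ Finset.mem_image_of_mem _ (Finset.mem_range.2 hi))
  have hex : ∃ i, N ≤ i ∨ beta N c i ≤ y := ⟨N, Or.inl le_rfl⟩
  obtain ⟨k, hk, hmin⟩ : ∃ k, (N ≤ k ∨ beta N c k ≤ y) ∧ ∀ i < k, ¬ (N ≤ i ∨ beta N c i ≤ y) :=
    ⟨Nat.find hex, Nat.find_spec hex, fun i => Nat.find_min hex⟩
  have hkN : k ≤ N := by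
    by_contra h
    exact hmin N (not_le.1 h) (Or.inl le_rfl)
  have hky : N - k ≤ y ∧ rowLength c k ≤ y - (N - k) := by
    rcases hkN.eq_or_lt with rfl | h
    · simp [rowLength_eq_zero c hN]
    · have h1 := hk.resolve_left (not_le.2 h)
      have h2 := hne k h
      unfold beta at h1 h2
      omega
  have hcol : colLength c (y - (N - k)) = k := by
    refine eq_of_forall_lt_iff fun i => ?_
    rw [lt_colLength_iff]
    constructor
    · intro h
      by_contra hik
      have := rowLength_antitone c (not_lt.1 hik)
      omega
    · intro h
      have h1 := hmin i h
      have h2 := rowLength_antitone c (show i ≤ k - 1 by omega)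
      have h3 := hmin (k - 1) (by omega)
      unfold beta at h3
      omega
  exact ⟨y - (N - k), by rw [hcol]; omega⟩

theorem beta_eq_add_hookLength {N : ℕ} (hN : m ≤ N) (c : Nat.Partition m) {i j : ℕ} (hi : i < N)
    (hij : j < rowLength c i) :
    beta N c i = N + j - colLength c j + hookLength c i j := by
  have h1 := (lt_colLength_iff c i j).2 hij
  have h2 := colLength_le hN c j
  change _ = _ + ((rowLength c i - j + (colLength c j - i)) - 1)
  unfold beta
  omega

theorem beta_lt {N : ℕ} (c : Nat.Partition m) {i j : ℕ} (hi : i < N)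
    (hij : rowLength c i ≤ j) : beta N c i < N + j - colLength c j := by
  have h1 := mt (lt_colLength_iff c i j).1 (not_lt.2 hij)
  unfold beta
  omega

theorem isTCore_iff {N t : ℕ} (hN : m ≤ N) (ht : 1 ≤ t) (c : Nat.Partition m) :
    IsTCore t c ↔ ∀ x ∈ betaSet N c, t ≤ x → x - t ∈ betaSet N c := by
  have hnot : ∀ j, N + j - colLength c j ∉ betaSet N c := by
    intro j hj
    obtain ⟨i, hi, h⟩ := Finset.mem_image.1 hj
    rw [Finset.mem_range] at hi
    rcases lt_or_ge j (rowLength c i) with h' | h'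
    · have h1 := (lt_colLength_iff c i j).2 h'
      have h2 := colLength_le hN c j
      unfold beta at h
      omega
    · exact (beta_lt c hi h').ne h
  constructor
  · intro h x hx htx
    obtain ⟨i, hi, rfl⟩ := Finset.mem_image.1 hx
    rw [Finset.mem_range] at hi
    by_contra hn
    obtain ⟨j, hj⟩ := (mem_betaSet_or_exists hN c (beta N c i - t)).resolve_left hn
    have hij : j < rowLength c i := by
      by_contra hlt
      have := beta_lt c hi (not_lt.1 hlt)
      omega
    have h1 := beta_eq_add_hookLength hN c hi hij
    exact h i j hij (by rw [show hookLength c i j = t by omega])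
  · rintro h i j hij ⟨s, hs⟩
    have hi : i < N := by
      by_contra hlt
      have : rowLength c i = 0 := rowLength_eq_zero c (hN.trans (not_lt.1 hlt))
      rw [rowLength] at this
      omega
    have h1 := beta_eq_add_hookLength hN c hi hij
    have h2 : ∀ s, t * s ≤ beta N c i → beta N c i - t * s ∈ betaSet N c := by
      intro s
      induction s with
      | zero => intro _; exact Finset.mem_image_of_mem _ (Finset.mem_range.2 hi)
      | succ s ih =>
        intro hs
        rw [Nat.mul_succ] at hs ⊢
        rw [← Nat.sub_sub]
        exact h _ (ih (by omega)) (by omega)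
    have h3 := h2 s (by omega)
    rw [show beta N c i - t * s = N + j - colLength c j by omega] at h3
    exact hnot j h3

end BetaSets

section Abacus

/-- The set of the bead positions on an abacus with `t` runners whose `j`-th runner carries
`l j` beads, pushed down as far as possible. -/
def abacus (t : ℕ) (l : ℕ →₀ ℕ) : Finset ℕ :=
  (Finset.range t).biUnion fun j => (Finset.range (l j)).image fun y => j + t * y

/-- The numbers of elements of `X` in the residue classes modulo `t`. -/
noncomputable def runnerCount (t : ℕ) (X : Finset ℕ) : ℕ →₀ ℕ :=
  Finsupp.onFinset (X.image (· % t)) (fun j => (X.filter (· % t = j)).card) fun j hj => by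
    obtain ⟨x, hx⟩ := Finset.card_ne_zero.1 hj
    rw [Finset.mem_filter] at hx
    exact Finset.mem_image.2 ⟨x, hx⟩

variable {t : ℕ}

theorem runnerCount_apply (X : Finset ℕ) (j : ℕ) :
    runnerCount t X j = (X.filter (· % t = j)).card := rfl

theorem mem_abacus (ht : 1 ≤ t) {l : ℕ →₀ ℕ} {x : ℕ} : x ∈ abacus t l ↔ x / t < l (x % t) := by
  simp only [abacus, Finset.mem_biUnion, Finset.mem_image, Finset.mem_range]
  constructor
  · rintro ⟨j, hj, y, hy, rfl⟩
    rwa [Nat.add_mul_div_left _ _ ht, Nat.div_eq_of_lt hj, zero_add, Nat.add_mul_mod_self_left,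
      Nat.mod_eq_of_lt hj]
  · exact fun h => ⟨x % t, Nat.mod_lt _ ht, x / t, h, Nat.mod_add_div x t⟩

theorem sum_abacus {M : Type*} [AddCommMonoid M] (ht : 1 ≤ t) (l : ℕ →₀ ℕ) (f : ℕ → M) :
    ∑ x ∈ abacus t l, f x = ∑ j ∈ Finset.range t, ∑ y ∈ Finset.range (l j), f (j + t * y) := by
  rw [abacus, Finset.sum_biUnion]
  · refine Finset.sum_congr rfl fun j _ => Finset.sum_image fun y _ z _ h => ?_
    exact Nat.eq_of_mul_eq_mul_left ht (Nat.add_left_cancel h)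
  · intro i hi j hj hij
    simp only [Finset.coe_range, Set.mem_Iio] at hi hj
    refine Finset.disjoint_left.2 fun x hx hx' => hij ?_
    obtain ⟨y, _, rfl⟩ := Finset.mem_image.1 hx
    obtain ⟨z, _, h⟩ := Finset.mem_image.1 hx'
    have := congrArg (· % t) h
    simpa [Nat.mod_eq_of_lt hi, Nat.mod_eq_of_lt hj] using this.symm

theorem card_abacus (ht : 1 ≤ t) (l : ℕ →₀ ℕ) :
    (abacus t l).card = ∑ j ∈ Finset.range t, l j := by
  rw [Finset.card_eq_sum_ones, sum_abacus ht]
  simp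

theorem runnerCount_abacus (ht : 1 ≤ t) (l : ℕ →₀ ℕ) {j : ℕ} (hj : j < t) :
    runnerCount t (abacus t l) j = l j := by
  rw [runnerCount_apply]
  have : (abacus t l).filter (· % t = j) = (Finset.range (l j)).image fun y => j + t * y := by
    ext x
    rw [Finset.mem_filter, mem_abacus ht, Finset.mem_image]
    constructor
    · rintro ⟨h, rfl⟩
      exact ⟨x / t, Finset.mem_range.2 h, Nat.mod_add_div x t⟩
    · rintro ⟨y, hy, rfl⟩
      rw [Nat.add_mul_div_left _ _ ht, Nat.div_eq_of_lt hj, zero_add, Nat.add_mul_mod_self_left,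
        Nat.mod_eq_of_lt hj]
      exact ⟨Finset.mem_range.1 hy, rfl⟩
  rw [this, Finset.card_image_of_injective _ fun y z h =>
    Nat.eq_of_mul_eq_mul_left ht (Nat.add_left_cancel h), Finset.card_range]

theorem sub_mem_abacus (ht : 1 ≤ t) {l : ℕ →₀ ℕ} {x : ℕ} (hx : x ∈ abacus t l) (htx : t ≤ x) :
    x - t ∈ abacus t l := by
  rw [mem_abacus ht] at hx ⊢
  rw [← Nat.mod_eq_sub_mod htx]
  exact (Nat.div_le_div_right (Nat.sub_le x t)).trans_lt hx

theorem abacus_runnerCount (ht : 1 ≤ t) {X : Finset ℕ} (hX : ∀ x ∈ X, t ≤ x → x - t ∈ X) :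
    abacus t (runnerCount t X) = X := by
  ext x
  rw [mem_abacus ht, runnerCount_apply]
  obtain ⟨N, hN⟩ := X.bddAbove
  have hlow : ∀ d y, x % t + t * (y + d) ∈ X → x % t + t * y ∈ X := by
    intro d
    induction d with
    | zero => exact fun y h => h
    | succ d ih =>
      intro y h
      refine ih y ?_
      have := hX _ h (by rw [← add_assoc, Nat.mul_succ]; omega)
      rwa [← add_assoc, Nat.mul_succ, ← add_assoc, Nat.add_sub_cancel] at this
  have hcard : (X.filter (· % t = x % t)).card =
      ((Finset.range (N + 1)).filter fun y => x % t + t * y ∈ X).card := by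
    refine (Finset.card_bij (fun y _ => x % t + t * y) ?_ ?_ ?_).symm
    · intro y hy
      rw [Finset.mem_filter] at hy ⊢
      exact ⟨hy.2, by simp⟩
    · exact fun y _ z _ h => Nat.eq_of_mul_eq_mul_left ht (Nat.add_left_cancel h)
    · intro z hz
      rw [Finset.mem_filter] at hz
      have hzx : x % t + t * (z / t) = z := by rw [← hz.2, Nat.mod_add_div]
      refine ⟨z / t, ?_, hzx⟩
      rw [Finset.mem_filter, hzx, Finset.mem_range]
      exact ⟨Nat.lt_succ_of_le ((Nat.div_le_self _ _).trans (hN hz.1)), hz.1⟩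
  rw [hcard, lt_card_filter_range_iff (P := fun y => x % t + t * y ∈ X), Nat.mod_add_div]
  · intro i j hij hj
    exact hlow (j - i) i (by rwa [Nat.add_sub_cancel' hij])
  · intro i hi
    have := hN hi
    have := Nat.le_mul_of_pos_left i ht
    omega

theorem sum_runnerCount (ht : 1 ≤ t) (X : Finset ℕ) :
    ∑ j ∈ Finset.range t, runnerCount t X j = X.card := by
  simp only [runnerCount_apply]
  exact (Finset.card_eq_sum_card_fiberwise fun x _ =>
    Finset.mem_coe.2 (Finset.mem_range.2 (Nat.mod_lt _ ht))).symm

theorem runnerCount_mem_finsuppAntidiag (ht : 1 ≤ t) (X : Finset ℕ) :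
    runnerCount t X ∈ (Finset.range t).finsuppAntidiag X.card := by
  rw [Finset.mem_finsuppAntidiag]
  refine ⟨sum_runnerCount ht X, fun j hj => ?_⟩
  rw [Finsupp.mem_support_iff, runnerCount_apply] at hj
  obtain ⟨x, hx⟩ := Finset.card_ne_zero.1 hj
  rw [Finset.mem_filter] at hx
  rw [Finset.mem_range, ← hx.2]
  exact Nat.mod_lt _ ht

theorem two_mul_coreWeight_add {L : ℕ} {l : ℕ →₀ ℕ} (ht : 1 ≤ t)
    (hl : ∑ j ∈ Finset.range t, l j = t * L) :
    2 * coreWeight t L l + t * L * (t * L - 1) = 2 * ∑ x ∈ abacus t l, x := by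
  have hchoose : ∀ n : ℕ, (∑ y ∈ Finset.range n, (y : ℤ)) * 2 = n * (n - 1) := fun n => by
    induction n with
    | zero => simp
    | succ n ih => rw [Finset.sum_range_succ, add_mul, ih]; push_cast; ring
  have hN : ((t * L * (t * L - 1) : ℕ) : ℤ) = t * L * (t * L - 1) := by
    rw [← Nat.cast_mul, ← Finset.sum_range_id_mul_two, ← hchoose]
    push_cast
    rfl
  rw [Nat.cast_mul, Nat.cast_mul] at hN
  have hterm : ∀ j ∈ Finset.range t,
      2 * ((j * triangular (l j - L) + (t - j) * triangular (l j - L - 1) : ℕ) : ℤ) =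
      2 * ∑ y ∈ Finset.range (l j), ((j : ℤ) + t * y) +
        (-2 * t * L * l j + (t * L * L + t * L) - 2 * L * j) := by
    intro j hj
    have h1 := two_mul_triangular (l j - L)
    have h2 := two_mul_triangular (l j - L - 1)
    rw [Finset.sum_add_distrib, ← Finset.mul_sum, Finset.sum_const, Finset.card_range]
    push_cast [Nat.cast_sub (Finset.mem_range.1 hj).le, nsmul_eq_mul]
    linear_combination (j : ℤ) * h1 + ((t : ℤ) - j) * h2 - (t : ℤ) * hchoose (l j)
  have hl' : ∑ j ∈ Finset.range t, (l j : ℤ) = t * L := by exact_mod_cast hl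
  zify
  rw [sum_abacus ht, coreWeight]
  simp only [Nat.cast_sum]
  rw [Finset.mul_sum, Finset.sum_congr rfl hterm, hN]
  push_cast
  simp only [Finset.sum_add_distrib, Finset.sum_sub_distrib, ← Finset.mul_sum, hl',
    Finset.sum_const, Finset.card_range, nsmul_eq_mul]
  linear_combination -(L : ℤ) * hchoose t

theorem card_core_eq {t L m : ℕ} (ht : 1 ≤ t) (hm : m ≤ t * L) :
    Nat.card {c : Nat.Partition m // IsTCore t c} =
      (((Finset.range t).finsuppAntidiag (t * L)).filter fun l => coreWeight t L l = m).card := by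
  rw [← Nat.card_eq_finsetCard]
  have hweight : ∀ l ∈ (Finset.range t).finsuppAntidiag (t * L),
      coreWeight t L l = m ↔ 2 * ∑ x ∈ abacus t l, x = 2 * m + t * L * (t * L - 1) := by
    intro l hl
    rw [← two_mul_coreWeight_add ht (Finset.mem_finsuppAntidiag.1 hl).1]
    omega
  have habacus : ∀ c : Nat.Partition m, IsTCore t c →
      abacus t (runnerCount t (betaSet (t * L) c)) = betaSet (t * L) c := fun c hc =>
    abacus_runnerCount ht ((isTCore_iff hm ht c).1 hc)
  have hmem : ∀ c : Nat.Partition m, runnerCount t (betaSet (t * L) c) ∈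
      (Finset.range t).finsuppAntidiag (t * L) := fun c => by
    simpa only [card_betaSet] using runnerCount_mem_finsuppAntidiag ht (betaSet (t * L) c)
  refine Nat.card_congr (Equiv.ofBijective (fun c => ⟨runnerCount t (betaSet (t * L) c.1),
    Finset.mem_filter.2 ⟨hmem c.1, (hweight _ (hmem c.1)).2 ?_⟩⟩) ⟨?_, ?_⟩)
  · rw [habacus c.1 c.2, sum_betaSet hm]
  · intro c d h
    have h1 := congrArg (abacus t) (Subtype.ext_iff.1 h)
    simp only [habacus c.1 c.2, habacus d.1 d.2] at h1
    exact Subtype.ext (betaSet_injective hm h1)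
  · rintro ⟨l, hl⟩
    rw [Finset.mem_filter] at hl
    have hl1 := Finset.mem_finsuppAntidiag.1 hl.1
    obtain ⟨c, hc⟩ := exists_betaSet_eq ((card_abacus ht l).trans hl1.1)
      ((hweight l hl.1).1 hl.2)
    refine ⟨⟨c, (isTCore_iff hm ht c).2 ?_⟩, Subtype.ext (Finsupp.ext fun j => ?_)⟩
    · rw [hc]
      exact fun x => sub_mem_abacus ht
    · simp only [hc]
      by_cases hj : j < t
      · exact runnerCount_abacus ht l hj
      · rw [Finsupp.notMem_support_iff.1 fun h => hj (Finset.mem_range.1 (hl1.2 h))]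
        rw [runnerCount_apply, Finset.card_eq_zero, Finset.filter_eq_empty_iff]
        exact fun x _ h => hj (h ▸ Nat.mod_lt _ ht)

end Abacus

theorem stmt_2 (p : ℕ) (hp : p.Prime) (hp5 : 5 ≤ p) (r : ℕ) (hr1 : 1 ≤ r) (hr2 : r ≤ p - 1)
    (hr : p ∣ 8 * r + 1) :
    ∀ n i : ℕ, 1 ≤ i →
      p ∣ numA p (p * i - 3) (p * n + r) := by
  intro n i hi
  have : Fact p.Prime := ⟨hp⟩
  rw [← ZMod.natCast_eq_zero_iff, natCast_numA]
  set m := p * n + r with hm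
  refine coeff_pow_eq_zero_of_X_pow_dvd (D := m + 1) (i := i) (H := qPoch (PowerSeries.X ^ p) (m + 1))
    (by omega) (by omega) ?_ (Nat.sub_add_cancel (by nlinarith)) ?_
  · rw [hm, show 8 * (p * n + r) + 1 = p * (8 * n) + (8 * r + 1) by ring]
    exact (Nat.dvd_add_right (Nat.dvd_mul_right _ _)).2 hr
  · have h := X_pow_dvd_qPoch_mul_sum_coreWeight (ZMod p) (t := p) hp.one_le
      (le_refl (2 * (m + 1) + 1))
    set L := 2 * (m + 1) + 1 with hL
    have h1 : PowerSeries.X ^ (m + 1) ∣ (PowerSeries.mk fun m =>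
        (Nat.card {c : Nat.Partition m // IsTCore p c} : ZMod p)) -
        ∑ l ∈ (Finset.range p).finsuppAntidiag (p * L), PowerSeries.X ^ coreWeight p L l := by
      rw [PowerSeries.X_pow_dvd_iff]
      intro d hd
      rw [map_sub, PowerSeries.coeff_mk, card_core_eq (L := L) hp.one_le (by nlinarith), map_sum]
      simp only [PowerSeries.coeff_X_pow, Finset.sum_boole, eq_comm, sub_self]
    have h2 := dvd_add h (h1.mul_left (qPoch PowerSeries.X (m + 1)))
    convert h2 using 1
    ring
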